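/- H¹ continuous dependence on data for the regularized nonlinear filter equation: fix α>0, assume β ≤ A ≤ 1 (0<β<1), A ∈ C^{0,1}(ℝ³) with Lipschitz constant C_A, and φ ∈ L²(𝕋³). For i=1,2 let u_i ∈ L^∞([0,T],L²_s(𝕋³)) and let u_{i,α} ∈ L^∞([0,T],H¹(𝕋³)) be the corresponding weak solutions of −α² div(A(φ∗u_i)(∇⊗u_{i,α})ᵀ) + u_{i,α} = u_i, div(u_{i,α})=0. Set L₁ = α² C_A ‖φ‖_{L²}. Then for all 0≤t≤T, ‖u_{1,α}(t,·) − u_{2,α}(t,·)‖_{H¹} ≤ K₁ (‖u₂(t,·)‖_{L²} + 1) ‖u₁(t,·) − u₂(t,·)‖_{L²}, with K₁ ≃ max(K₀^{3/2} L₁, K₀) and K₀ ≃ 1/min(α²β,1). -/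

import Mathlib

/-!
Common framework for the Navier–Stokes-alpha model with a nonlinear filter equation,
on the periodic torus `𝕋³ = [0,L]³`.  Function spaces are encoded through Fourier
coefficients on the frequency lattice `(2π/L)ℤ³`.
-/

open MeasureTheory Real Filter Topology

noncomputable section

namespace NSAlpha

/-- spatial points -/
abbrev Pt := Fin 3 → ℝ
/-- values of vector fields -/
abbrev Vec := Fin 3 → ℝ
/-- the frequency lattice indices -/
abbrev Lat := Fin 3 → ℤ

/-- fundamental domain `[0,L]³` of the torus of period `L` -/
def box (L : ℝ) : Set Pt := Set.univ.pi fun _ => Set.Icc (0 : ℝ) L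

/-- `L`-periodicity of a vector field -/
def SpacePeriodic (L : ℝ) (g : Pt → Vec) : Prop :=
  ∀ (x : Pt) (n : Lat), g (fun i => x i + L * (n i : ℝ)) = g x

/-- `L`-periodicity of a scalar function -/
def SpacePeriodicS (L : ℝ) (g : Pt → ℝ) : Prop :=
  ∀ (x : Pt) (n : Lat), g (fun i => x i + L * (n i : ℝ)) = g x

/-- the frequency `2πk/L` -/
def freq (L : ℝ) (k : Lat) (i : Fin 3) : ℝ := (2 * π / L) * (k i : ℝ)

/-- `|2πk/L|²` -/
def freqNormSq (L : ℝ) (k : Lat) : ℝ := ∑ i, freq L k i ^ 2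

/-- the character `e^{-i k·x}` -/
def em (L : ℝ) (k : Lat) (x : Pt) : ℂ :=
  Complex.exp (-Complex.I * ((∑ i, freq L k i * x i : ℝ) : ℂ))

/-- `k`-th Fourier coefficient of a scalar function on the torus -/
def fcS (L : ℝ) (g : Pt → ℝ) (k : Lat) : ℂ :=
  (L ^ 3)⁻¹ • ∫ x in box L, em L k x * (g x : ℂ)

/-- `k`-th Fourier coefficient of a vector field (componentwise) -/
def fc (L : ℝ) (g : Pt → Vec) (k : Lat) (i : Fin 3) : ℂ :=
  fcS L (fun x => g x i) k

/-- squared norm of a complex coefficient vector -/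
def cnormSq (c : Fin 3 → ℂ) : ℝ := ∑ i, Complex.normSq (c i)

/-- squared homogeneous Sobolev norm `‖g‖²_{Ḣ^s}` (via Fourier series) -/
def homSobSq (L s : ℝ) (g : Pt → Vec) : ℝ :=
  L ^ 3 * ∑' k : Lat, freqNormSq L k ^ s * cnormSq (fc L g k)

/-- summability of the `Ḣ^s` Fourier series -/
def homSummable (L s : ℝ) (g : Pt → Vec) : Prop :=
  Summable fun k : Lat => freqNormSq L k ^ s * cnormSq (fc L g k)

/-- squared nonhomogeneous Sobolev norm `‖g‖²_{H^s}` -/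
def sobSq (L s : ℝ) (g : Pt → Vec) : ℝ :=
  L ^ 3 * ∑' k : Lat, (1 + freqNormSq L k) ^ s * cnormSq (fc L g k)

/-- summability of the `H^s` Fourier series -/
def sobSummable (L s : ℝ) (g : Pt → Vec) : Prop :=
  Summable fun k : Lat => (1 + freqNormSq L k) ^ s * cnormSq (fc L g k)

/-- squared homogeneous Sobolev norm of a scalar function -/
def homSobSqS (L s : ℝ) (g : Pt → ℝ) : ℝ :=
  L ^ 3 * ∑' k : Lat, freqNormSq L k ^ s * Complex.normSq (fcS L g k)

/-- zero mean value -/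
def ZeroMean (L : ℝ) (g : Pt → Vec) : Prop := ∀ i, fc L g 0 i = 0

/-- divergence-free condition, in the Fourier (distributional) sense -/
def DivFree (L : ℝ) (g : Pt → Vec) : Prop :=
  ∀ k : Lat, ∑ i, (freq L k i : ℂ) * fc L g k i = 0

/-- membership in `L²_s(𝕋³)` : periodic, integrable, zero-mean, divergence-free,
with square-summable Fourier coefficients -/
def MemL2s (L : ℝ) (g : Pt → Vec) : Prop :=
  SpacePeriodic L g ∧ IntegrableOn g (box L) ∧ ZeroMean L g ∧ DivFree L g ∧
    homSummable L 0 g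

/-- membership in the (zero-mean) Sobolev space `H^s(𝕋³)` -/
def MemHs (L s : ℝ) (g : Pt → Vec) : Prop :=
  SpacePeriodic L g ∧ IntegrableOn g (box L) ∧ ZeroMean L g ∧ sobSummable L s g

/-- periodic convolution `φ ∗ g` on the torus -/
def pconv (L : ℝ) (φ : Pt → ℝ) (g : Pt → Vec) (x : Pt) : Vec :=
  fun i => ∫ y in box L, φ y * g (fun a => x a - y a) i

/-- the Fourier transform of `−α² div(B (∇⊗v)ᵀ) + v`, tested against `e^{-ik·x}eᵢ`
(normalized by `L³`); the derivative of `v` is taken in the weak (Fourier) sense. -/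
def filterLHS (L α : ℝ) (B : Pt → ℝ) (v : Pt → Vec) (k : Lat) (i : Fin 3) : ℂ :=
  ((α ^ 2 : ℝ) : ℂ) *
      ∑' m : Lat, ((∑ a, freq L k a * freq L m a : ℝ) : ℂ) *
        fcS L B (fun a => k a - m a) * fc L v m i
    + fc L v k i

/-- weak formulation of the nonlinear filter equation `−α² div(B (∇⊗v)ᵀ) + v = g` -/
def FilterEq (L α : ℝ) (B : Pt → ℝ) (v g : Pt → Vec) : Prop :=
  ∀ (k : Lat) (i : Fin 3), filterLHS L α B v k i = fc L g k i

/-- Fourier coefficients of the transport term `(v·∇)g = div(g ⊗ v)` (when `div v = 0`) -/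
def transportCoef (L : ℝ) (g v : Pt → Vec) (k : Lat) (i : Fin 3) : ℂ :=
  Complex.I * ∑ j, ((freq L k j : ℝ) : ℂ) * fcS L (fun x => g x i * v x j) k

/-- the Leray projector on Fourier coefficients -/
def leray (L : ℝ) (k : Lat) (c : Fin 3 → ℂ) (i : Fin 3) : ℂ :=
  if k = 0 then c i
  else c i - ((∑ j, c j * ((freq L k j : ℝ) : ℂ)) / ((freqNormSq L k : ℝ) : ℂ)) *
    ((freq L k i : ℝ) : ℂ)

/-- squared `Ḣ⁻¹` norm of a family of Fourier coefficients -/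
def hNegSobSq (L : ℝ) (c : Lat → Fin 3 → ℂ) : ℝ :=
  L ^ 3 * ∑' k : Lat, freqNormSq L k ^ (-(1 : ℝ)) * cnormSq (c k)

/-- an external force in `L²_loc([0,∞), Ḣ⁻¹(𝕋³))`, divergence-free and zero-mean,
represented through its (time-dependent) Fourier coefficients -/
structure ForceData (L : ℝ) where
  coef : ℝ → Lat → Fin 3 → ℂ
  reality : ∀ t k i, coef t (fun j => -k j) i = starRingEnd ℂ (coef t k i)
  zeroMean : ∀ t i, coef t 0 i = 0
  divFree : ∀ t k, ∑ i, (freq L k i : ℂ) * coef t k i = 0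
  hsummable : ∀ t, Summable fun k : Lat => freqNormSq L k ^ (-(1 : ℝ)) * cnormSq (coef t k)
  locL2 : ∀ T : ℝ, 0 < T → IntegrableOn (fun t => hNegSobSq L (coef t)) (Set.Icc 0 T)

/-- a stationary (time-independent) force in `Ḣ⁻¹(𝕋³) ∩ L²_s(𝕋³)` -/
structure StatForce (L : ℝ) where
  coef : Lat → Fin 3 → ℂ
  reality : ∀ k i, coef (fun j => -k j) i = starRingEnd ℂ (coef k i)
  zeroMean : ∀ i, coef 0 i = 0
  divFree : ∀ k, ∑ i, (freq L k i : ℂ) * coef k i = 0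
  memHneg : Summable fun k : Lat => freqNormSq L k ^ (-(1 : ℝ)) * cnormSq (coef k)
  memL2 : Summable fun k : Lat => cnormSq (coef k)

/-- the duality pairing `⟨f, g⟩_{Ḣ⁻¹×Ḣ¹}` -/
def pairing (L : ℝ) (c : Lat → Fin 3 → ℂ) (g : Pt → Vec) : ℝ :=
  L ^ 3 * (∑' k : Lat, ∑ i, c k i * starRingEnd ℂ (fc L g k i)).re

/-- the `L²` inner product of two fields (by Parseval) -/
def l2Pair (L : ℝ) (g h : Pt → Vec) : ℝ :=
  L ^ 3 * (∑' k : Lat, ∑ i, fc L g k i * starRingEnd ℂ (fc L h k i)).re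

/-- weak formulation of the momentum equation with pressure,
`∂ₜu − νΔu + (v·∇)u + ∇P = f`, `u(0,·)=u₀`, tested in Fourier in space
and against smooth compactly supported functions of time -/
def WeakMomentum (L ν : ℝ) (fcoef : ℝ → Lat → Fin 3 → ℂ) (u v : ℝ → Pt → Vec)
    (P : ℝ → Pt → ℝ) (u₀ : Pt → Vec) : Prop :=
  ∀ (k : Lat) (i : Fin 3) (θ : ℝ → ℝ), ContDiff ℝ (⊤ : ℕ∞) θ → HasCompactSupport θ →
    (∫ t in Set.Ioi (0 : ℝ),
        ((-(deriv θ t) : ℝ) : ℂ) * fc L (u t) k i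
          + ((θ t : ℝ) : ℂ) * (((ν * freqNormSq L k : ℝ) : ℂ) * fc L (u t) k i
              + transportCoef L (u t) (v t) k i
              + Complex.I * ((freq L k i : ℝ) : ℂ) * fcS L (P t) k
              - fcoef t k i))
      = ((θ 0 : ℝ) : ℂ) * fc L u₀ k i

/-- weak formulation of the Leray-projected momentum equation,
`∂ₜu − νΔu + ℙ((v·∇)u) = f`, `u(0,·)=u₀` -/
def WeakMomentumProj (L ν : ℝ) (fcoef : ℝ → Lat → Fin 3 → ℂ) (u v : ℝ → Pt → Vec)
    (u₀ : Pt → Vec) : Prop :=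
  ∀ (k : Lat) (i : Fin 3) (θ : ℝ → ℝ), ContDiff ℝ (⊤ : ℕ∞) θ → HasCompactSupport θ →
    (∫ t in Set.Ioi (0 : ℝ),
        ((-(deriv θ t) : ℝ) : ℂ) * fc L (u t) k i
          + ((θ t : ℝ) : ℂ) * (((ν * freqNormSq L k : ℝ) : ℂ) * fc L (u t) k i
              + leray L k (transportCoef L (u t) (v t) k) i
              - fcoef t k i))
      = ((θ 0 : ℝ) : ℂ) * fc L u₀ k i

/-- weak formulation of the Leray-projected momentum equation on the whole line `ℝ`
(for eternal solutions), with a stationary force -/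
def WeakMomentumProjEternal (L ν : ℝ) (fcoef : Lat → Fin 3 → ℂ) (u v : ℝ → Pt → Vec) :
    Prop :=
  ∀ (k : Lat) (i : Fin 3) (θ : ℝ → ℝ), ContDiff ℝ (⊤ : ℕ∞) θ → HasCompactSupport θ →
    (∫ t : ℝ,
        ((-(deriv θ t) : ℝ) : ℂ) * fc L (u t) k i
          + ((θ t : ℝ) : ℂ) * (((ν * freqNormSq L k : ℝ) : ℂ) * fc L (u t) k i
              + leray L k (transportCoef L (u t) (v t) k) i
              - fcoef k i))
      = 0

/-- the Leray energy inequality -/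
def EnergyIneq (L ν : ℝ) (fcoef : ℝ → Lat → Fin 3 → ℂ) (u : ℝ → Pt → Vec)
    (u₀ : Pt → Vec) : Prop :=
  ∀ t : ℝ, 0 ≤ t →
    homSobSq L 0 (u t) + 2 * ν * ∫ s in Set.Ioc (0 : ℝ) t, homSobSq L 1 (u s)
      ≤ homSobSq L 0 u₀ + 2 * ∫ s in Set.Ioc (0 : ℝ) t, pairing L (fcoef s) (u s)

/-- weak Leray solution of the Navier–Stokes-alpha system with a general
filter coefficient map `Bmap` (the filter coefficient may depend on `u`) -/
structure IsLeraySolGen (L ν α : ℝ) (Bmap : (Pt → Vec) → Pt → ℝ) (u₀ : Pt → Vec)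
    (f : ForceData L) (u uα : ℝ → Pt → Vec) (P : ℝ → Pt → ℝ) : Prop where
  uMem : ∀ t : ℝ, 0 ≤ t → MemL2s L (u t)
  uLocBdd : ∀ T : ℝ, 0 < T → ∃ M : ℝ, ∀ t ∈ Set.Icc (0 : ℝ) T, homSobSq L 0 (u t) ≤ M
  uH1ae : ∀ T : ℝ, 0 < T →
    ∀ᵐ t ∂(volume.restrict (Set.Icc (0 : ℝ) T)), homSummable L 1 (u t)
  uH1int : ∀ T : ℝ, 0 < T → IntegrableOn (fun t => homSobSq L 1 (u t)) (Set.Icc (0 : ℝ) T)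
  uaMem : ∀ t : ℝ, 0 ≤ t → MemHs L 1 (uα t) ∧ DivFree L (uα t)
  uaLocBdd : ∀ T : ℝ, 0 < T → ∃ M : ℝ, ∀ t ∈ Set.Icc (0 : ℝ) T, sobSq L 1 (uα t) ≤ M
  pPeriodic : ∀ t : ℝ, 0 ≤ t → SpacePeriodicS L (P t)
  pL2 : ∀ t : ℝ, 0 ≤ t → IntegrableOn (fun x => P t x ^ 2) (box L)
  pLoc : ∀ T : ℝ, 0 < T →
    IntegrableOn (fun t => ∫ x in box L, P t x ^ 2) (Set.Icc (0 : ℝ) T)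
  momentum : WeakMomentum L ν f.coef u uα P u₀
  filter : ∀ t : ℝ, 0 ≤ t → FilterEq L α (Bmap (u t)) (uα t) (u t)
  energy : EnergyIneq L ν f.coef u u₀

/-- weak Leray solution of the Navier–Stokes-alpha model with the
regularized nonlinear filter `−α² div(A(φ∗u)(∇⊗u_α)ᵀ) + u_α = u` -/
def IsLeraySol (L ν α : ℝ) (A : Vec → ℝ) (φ : Pt → ℝ) (u₀ : Pt → Vec) (f : ForceData L)
    (u uα : ℝ → Pt → Vec) (P : ℝ → Pt → ℝ) : Prop :=
  IsLeraySolGen L ν α (fun g x => A (pconv L φ g x)) u₀ f u uα P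

/-- weak Leray solution of the Leray-projected system with stationary force,
with a general filter coefficient map -/
structure IsLeraySolProjGen (L ν α : ℝ) (Bmap : (Pt → Vec) → Pt → ℝ) (u₀ : Pt → Vec)
    (f : StatForce L) (u uα : ℝ → Pt → Vec) : Prop where
  uMem : ∀ t : ℝ, 0 ≤ t → MemL2s L (u t)
  uLocBdd : ∀ T : ℝ, 0 < T → ∃ M : ℝ, ∀ t ∈ Set.Icc (0 : ℝ) T, homSobSq L 0 (u t) ≤ M
  uH1ae : ∀ T : ℝ, 0 < T →
    ∀ᵐ t ∂(volume.restrict (Set.Icc (0 : ℝ) T)), homSummable L 1 (u t)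
  uH1int : ∀ T : ℝ, 0 < T → IntegrableOn (fun t => homSobSq L 1 (u t)) (Set.Icc (0 : ℝ) T)
  uaMem : ∀ t : ℝ, 0 ≤ t → MemHs L 1 (uα t) ∧ DivFree L (uα t)
  momentum : WeakMomentumProj L ν (fun _ => f.coef) u uα u₀
  filter : ∀ t : ℝ, 0 ≤ t → FilterEq L α (Bmap (u t)) (uα t) (u t)
  energy : EnergyIneq L ν (fun _ => f.coef) u u₀

/-- weak Leray solution of the projected Navier–Stokes-alpha model (regularized filter) -/
def IsLeraySolProj (L ν α : ℝ) (A : Vec → ℝ) (φ : Pt → ℝ) (u₀ : Pt → Vec)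
    (f : StatForce L) (u uα : ℝ → Pt → Vec) : Prop :=
  IsLeraySolProjGen L ν α (fun g x => A (pconv L φ g x)) u₀ f u uα

/-- `S` realizes the solution semi-group of the projected Navier–Stokes-alpha model -/
def IsSolutionSemigroup (L ν α : ℝ) (A : Vec → ℝ) (φ : Pt → ℝ) (f : StatForce L)
    (S : ℝ → (Pt → Vec) → Pt → Vec) : Prop :=
  (∀ g : Pt → Vec, MemL2s L g →
      S 0 g = g ∧ ∃ uα, IsLeraySolProj L ν α A φ g f (fun t => S t g) uα) ∧
    ∀ g : Pt → Vec, MemL2s L g → ∀ s t : ℝ, 0 ≤ s → 0 ≤ t → S (t + s) g = S t (S s g)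

/-- the `L²(𝕋³)` distance between two fields -/
def dL2 (L : ℝ) (g h : Pt → Vec) : ℝ :=
  Real.sqrt (homSobSq L 0 fun x i => g x i - h x i)

/-- bounded subsets of `L²_s(𝕋³)` -/
def IsBoundedL2s (L : ℝ) (B : Set (Pt → Vec)) : Prop :=
  (∀ g ∈ B, MemL2s L g) ∧ ∃ R : ℝ, ∀ g ∈ B, homSobSq L 0 g ≤ R

/-- (sequential) compactness in the strong topology of `L²(𝕋³)` -/
def IsCompactL2 (L : ℝ) (K : Set (Pt → Vec)) : Prop :=
  ∀ seq : ℕ → Pt → Vec, (∀ n, seq n ∈ K) →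
    ∃ g ∈ K, ∃ ψ : ℕ → ℕ, StrictMono ψ ∧
      Tendsto (fun n => dL2 L (seq (ψ n)) g) atTop (nhds 0)

/-- global attractor of the semi-group `S` acting on `L²_s(𝕋³)` : compact,
strictly invariant, and attracting all bounded sets -/
def IsGlobalAttractor (L : ℝ) (S : ℝ → (Pt → Vec) → Pt → Vec)
    (𝒜 : Set (Pt → Vec)) : Prop :=
  (∀ g ∈ 𝒜, MemL2s L g) ∧ IsCompactL2 L 𝒜 ∧
    (∀ t : ℝ, 0 ≤ t → S t '' 𝒜 = 𝒜) ∧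
    ∀ B : Set (Pt → Vec), IsBoundedL2s L B → ∀ ε : ℝ, 0 < ε →
      ∃ T : ℝ, 0 < T ∧ ∀ t : ℝ, T < t → ∀ g ∈ B, ∃ a ∈ 𝒜, dL2 L (S t g) a < ε

/-- eternal solution (defined for all `t ∈ ℝ`) of the projected system -/
structure IsEternalSolGen (L ν α : ℝ) (Bmap : (Pt → Vec) → Pt → ℝ) (f : StatForce L)
    (u uα : ℝ → Pt → Vec) : Prop where
  uMem : ∀ t : ℝ, MemL2s L (u t)
  uLocBdd : ∀ T : ℝ, 0 < T → ∃ M : ℝ, ∀ t ∈ Set.Icc (-T) T, homSobSq L 0 (u t) ≤ M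
  uH1int : ∀ T : ℝ, 0 < T → IntegrableOn (fun t => homSobSq L 1 (u t)) (Set.Icc (-T) T)
  uaMem : ∀ t : ℝ, MemHs L 1 (uα t) ∧ DivFree L (uα t)
  momentum : WeakMomentumProjEternal L ν f.coef u uα
  filter : ∀ t : ℝ, FilterEq L α (Bmap (u t)) (uα t) (u t)

/-- eternal solution of the projected Navier–Stokes-alpha model (regularized filter) -/
def IsEternalSol (L ν α : ℝ) (A : Vec → ℝ) (φ : Pt → ℝ) (f : StatForce L)
    (u uα : ℝ → Pt → Vec) : Prop :=
  IsEternalSolGen L ν α (fun g x => A (pconv L φ g x)) f u uα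

/-- bounded eternal solution -/
def IsBoundedEternalSol (L ν α : ℝ) (A : Vec → ℝ) (φ : Pt → ℝ) (f : StatForce L)
    (u uα : ℝ → Pt → Vec) : Prop :=
  IsEternalSol L ν α A φ f u uα ∧ ∃ M : ℝ, ∀ t : ℝ, homSobSq L 0 (u t) ≤ M

/-- the pointwise bounds `β ≤ A ≤ 1` on the indicator function -/
def IndicatorBounds (β : ℝ) (A : Vec → ℝ) : Prop := ∀ x : Vec, β ≤ A x ∧ A x ≤ 1

/-- `A ∈ C^{0,1}(ℝ³)` (Lipschitz continuity) -/
def IndicatorC01 (A : Vec → ℝ) : Prop := ∃ C : ℝ, ∀ x y : Vec, |A x - A y| ≤ C * ‖x - y‖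

/-- `A ∈ C^{1,1}(ℝ³)` (continuously differentiable with bounded, Lipschitz derivative) -/
def IndicatorC11 (A : Vec → ℝ) : Prop :=
  ContDiff ℝ 1 A ∧ (∃ M : ℝ, ∀ x : Vec, ‖fderiv ℝ A x‖ ≤ M) ∧
    ∃ C : ℝ, ∀ x y : Vec, ‖fderiv ℝ A x - fderiv ℝ A y‖ ≤ C * ‖x - y‖

/-- `φ ∈ L²(𝕋³)` -/
def KernelL2 (L : ℝ) (φ : Pt → ℝ) : Prop :=
  SpacePeriodicS L φ ∧ IntegrableOn φ (box L) ∧ IntegrableOn (fun x => φ x ^ 2) (box L)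

/-- `‖φ‖_{L²(𝕋³)}` -/
def kernelL2Norm (L : ℝ) (φ : Pt → ℝ) : ℝ := Real.sqrt (∫ x in box L, φ x ^ 2)

/-- `‖φ‖²_{H¹(𝕋³)}` -/
def kernelH1Sq (L : ℝ) (φ : Pt → ℝ) : ℝ :=
  L ^ 3 * ∑' k : Lat, (1 + freqNormSq L k) * Complex.normSq (fcS L φ k)

/-- `φ ∈ H¹(𝕋³)` -/
def KernelH1 (L : ℝ) (φ : Pt → ℝ) : Prop :=
  KernelL2 L φ ∧ Summable fun k : Lat => (1 + freqNormSq L k) * Complex.normSq (fcS L φ k)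

/-- `‖φ‖_{H¹(𝕋³)}` -/
def kernelH1Norm (L : ℝ) (φ : Pt → ℝ) : ℝ := Real.sqrt (kernelH1Sq L φ)

/-- `‖∇A‖_{L^∞}` -/
def gradSup (A : Vec → ℝ) : ℝ := ⨆ x : Vec, ‖fderiv ℝ A x‖

/-- `sup_{0≤t≤T} ‖u(t)‖_{L²}` -/
def supNormL2 (L T : ℝ) (u : ℝ → Pt → Vec) : ℝ :=
  ⨆ t : Set.Icc (0 : ℝ) T, Real.sqrt (homSobSq L 0 (u ↑t))

/-- `sup_{0≤t≤T} ‖u(t)‖_{H¹}` -/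
def supNormH1 (L T : ℝ) (u : ℝ → Pt → Vec) : ℝ :=
  ⨆ t : Set.Icc (0 : ℝ) T, Real.sqrt (sobSq L 1 (u ↑t))

/-- the energy norm `‖u‖_{E_T}` -/
def eTNorm (L ν T : ℝ) (u : ℝ → Pt → Vec) : ℝ :=
  supNormL2 L T u + Real.sqrt (ν * ∫ t in Set.Ioc (0 : ℝ) T, homSobSq L 1 (u t))

/-- the constant `K₀ ≃ 1/min(α²β,1)` of the `H¹` filter estimate -/
def K0c (α β : ℝ) : ℝ := 1 / min (α ^ 2 * β) 1

/-- `L₁ = α² C_A ‖φ‖_{L²}` -/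
def L1c (L α CA : ℝ) (φ : Pt → ℝ) : ℝ := α ^ 2 * CA * kernelL2Norm L φ

/-- `L₂ = α² ‖∇A‖_{L^∞} ‖φ‖_{H¹}` -/
def L2c (L α : ℝ) (A : Vec → ℝ) (φ : Pt → ℝ) : ℝ := α ^ 2 * gradSup A * kernelH1Norm L φ

/-- `L₃ = α² ‖φ‖_{H¹} max(C′_A ‖φ‖_{H¹}, ‖∇A‖_{L^∞})` -/
def L3c (L α CA' : ℝ) (A : Vec → ℝ) (φ : Pt → ℝ) : ℝ :=
  α ^ 2 * kernelH1Norm L φ * max (CA' * kernelH1Norm L φ) (gradSup A)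

/-- `K₁ = max(K₀^{3/2} L₁, K₀)` -/
def K1c (L α β CA : ℝ) (φ : Pt → ℝ) : ℝ :=
  max (K0c α β ^ ((3 : ℝ) / 2) * L1c L α CA φ) (K0c α β)

/-- `K₂ = max(K₀^{3/2} L₂, K₀)` -/
def K2c (L α β : ℝ) (A : Vec → ℝ) (φ : Pt → ℝ) : ℝ :=
  max (K0c α β ^ ((3 : ℝ) / 2) * L2c L α A φ) (K0c α β)

/-- `K₃ = max(K₀K₂L₁, K₀K₁L₂, K₀^{3/2}L₃)` -/
def K3c (L α β CA CA' : ℝ) (A : Vec → ℝ) (φ : Pt → ℝ) : ℝ :=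
  max (max (K0c α β * K2c L α β A φ * L1c L α CA φ)
      (K0c α β * K1c L α β CA φ * L2c L α A φ))
    (K0c α β ^ ((3 : ℝ) / 2) * L3c L α CA' A φ)

/-- the quantity `K(α,β)` -/
def Kab (α β : ℝ) : ℝ :=
  if α ≤ 1 then 1 / (α ^ 5 * β ^ ((5 : ℝ) / 2))
  else if α ≤ 1 / Real.sqrt β then 1 / (α * β ^ ((5 : ℝ) / 2))
  else α ^ 4

/-- minimal number of `ε`-balls of `L²(𝕋³)` needed to cover `K` -/
def coveringNumber (L ε : ℝ) (K : Set (Pt → Vec)) : ℕ :=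
  sInf {n : ℕ | ∃ c : Fin n → Pt → Vec, ∀ g ∈ K, ∃ i, dL2 L g (c i) < ε}

/-- the fractal dimension `dim_f(K) = limsup_{ε→0⁺} N_ε(K)/ln(1/ε)` -/
def fractalDim (L : ℝ) (K : Set (Pt → Vec)) : ℝ :=
  Filter.limsup (fun ε : ℝ => (coveringNumber L ε K : ℝ) / Real.log (1 / ε))
    (nhdsWithin 0 (Set.Ioi 0))

/-- squared `L²` norm of the spectral projection `P_m` onto frequencies `|k| ≤ m` -/
def projNormSq (L : ℝ) (m : ℕ) (g : Pt → Vec) : ℝ :=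
  L ^ 3 * ∑' k : Lat,
    (if freqNormSq L k ≤ (m : ℝ) ^ 2 then (1 : ℝ) else 0) * cnormSq (fc L g k)

/-- test data for the weak-* topology of `L^∞(I, L²)` (elements of `L¹(I, L²)`) -/
def TestL1L2 (L : ℝ) (I : Set ℝ) (g : ℝ → Pt → Vec) : Prop :=
  (∀ t ∈ I, SpacePeriodic L (g t) ∧ IntegrableOn (g t) (box L) ∧ homSummable L 0 (g t)) ∧
    IntegrableOn (fun t => Real.sqrt (homSobSq L 0 (g t))) I

/-- test data for the weak topology of `L²(I, Ḣ¹)` (elements of `L²(I, Ḣ⁻¹)`),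
given as Fourier coefficients -/
def TestL2Hneg (L : ℝ) (I : Set ℝ) (c : ℝ → Lat → Fin 3 → ℂ) : Prop :=
  (∀ t ∈ I, Summable fun k : Lat => freqNormSq L k ^ (-(1 : ℝ)) * cnormSq (c t k)) ∧
    IntegrableOn (fun t => hNegSobSq L (c t)) I

/-- convergence in the weak-* topology of `E_T = L^∞([0,T],L²) ∩ L²([0,T],Ḣ¹)` -/
def WeakStarET (L T : ℝ) (un : ℕ → ℝ → Pt → Vec) (u : ℝ → Pt → Vec) : Prop :=
  (∀ g : ℝ → Pt → Vec, TestL1L2 L (Set.Ioc 0 T) g →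
    Tendsto (fun n => ∫ t in Set.Ioc (0 : ℝ) T, l2Pair L (un n t) (g t)) atTop
      (nhds (∫ t in Set.Ioc (0 : ℝ) T, l2Pair L (u t) (g t)))) ∧
  ∀ c : ℝ → Lat → Fin 3 → ℂ, TestL2Hneg L (Set.Ioc 0 T) c →
    Tendsto (fun n => ∫ t in Set.Ioc (0 : ℝ) T, pairing L (c t) (un n t)) atTop
      (nhds (∫ t in Set.Ioc (0 : ℝ) T, pairing L (c t) (u t)))

/-- scalar duality pairing `⟨c, g⟩` (with `c` given by Fourier coefficients) -/
def sPairCoef (L : ℝ) (c : Lat → ℂ) (g : Pt → ℝ) : ℝ :=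
  L ^ 3 * (∑' k : Lat, c k * starRingEnd ℂ (fcS L g k)).re

/-- scalar test data in `L²(I, Ḣ^{1/2})`, for the weak topology of `L²(I, Ḣ^{-1/2})` -/
def TestL2HhalfS (L : ℝ) (I : Set ℝ) (c : ℝ → Lat → ℂ) : Prop :=
  (∀ t ∈ I, Summable fun k : Lat => freqNormSq L k ^ ((1 : ℝ) / 2) * Complex.normSq (c t k)) ∧
    IntegrableOn
      (fun t => L ^ 3 * ∑' k : Lat, freqNormSq L k ^ ((1 : ℝ) / 2) * Complex.normSq (c t k)) I

/-- weak Leray solution of the classical Navier–Stokes equations,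
with pressure in `L²_loc Ḣ^{-1/2}` -/
structure IsLeraySolNSE (L ν : ℝ) (u₀ : Pt → Vec) (f : ForceData L)
    (u : ℝ → Pt → Vec) (P : ℝ → Pt → ℝ) : Prop where
  uMem : ∀ t : ℝ, 0 ≤ t → MemL2s L (u t)
  uLocBdd : ∀ T : ℝ, 0 < T → ∃ M : ℝ, ∀ t ∈ Set.Icc (0 : ℝ) T, homSobSq L 0 (u t) ≤ M
  uH1ae : ∀ T : ℝ, 0 < T →
    ∀ᵐ t ∂(volume.restrict (Set.Icc (0 : ℝ) T)), homSummable L 1 (u t)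
  uH1int : ∀ T : ℝ, 0 < T → IntegrableOn (fun t => homSobSq L 1 (u t)) (Set.Icc (0 : ℝ) T)
  pPeriodic : ∀ t : ℝ, 0 ≤ t → SpacePeriodicS L (P t)
  pIntegrable : ∀ t : ℝ, 0 ≤ t → IntegrableOn (P t) (box L)
  pLoc : ∀ T : ℝ, 0 < T →
    IntegrableOn (fun t => homSobSqS L (-(1 : ℝ) / 2) (P t)) (Set.Icc (0 : ℝ) T)
  momentum : WeakMomentum L ν f.coef u u P u₀
  energy : EnergyIneq L ν f.coef u u₀

/-- an approximation of the identity `(φ_n)` on the torus -/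
def IsApproxIdentity (L : ℝ) (φn : ℕ → Pt → ℝ) : Prop :=
  (∀ n, KernelL2 L (φn n) ∧ (∫ x in box L, φn n x) = 1) ∧
    ∀ g : Pt → Vec, SpacePeriodic L g → IntegrableOn g (box L) → homSummable L 0 g →
      Tendsto (fun n => homSobSq L 0 fun x i => pconv L (φn n) g x i - g x i)
        atTop (nhds 0)


section Torus
open UnitAddTorus
open scoped ComplexConjugate ENNReal

local instance instMSCircle : MeasureSpace UnitAddCircle := ⟨AddCircle.haarAddCircle⟩
local instance instHaarCircle : Measure.IsAddHaarMeasure (volume : Measure UnitAddCircle) :=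
  inferInstanceAs (Measure.IsAddHaarMeasure AddCircle.haarAddCircle)
local instance instProbCircle : IsProbabilityMeasure (volume : Measure UnitAddCircle) :=
  inferInstanceAs (IsProbabilityMeasure AddCircle.haarAddCircle)

abbrev Tor := UnitAddTorus (Fin 3)
abbrev EE := Lp ℂ 2 (volume : Measure Tor)

/-- coefficient -/
abbrev co (f : EE) (k : Lat) : ℂ := mFourierBasis.repr f k

lemma hasSum_co_inner (f g : EE) :
    HasSum (fun k => conj (co f k) * co g k) (inner ℂ f g) := by
  refine HasSum.congr_fun (mFourierBasis.hasSum_inner_mul_inner f g) (fun n ↦ ?_)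
  simp only [HilbertBasis.repr_apply_apply, inner_conj_symm]

lemma hasSum_co_sq (f : EE) : HasSum (fun k => ‖co f k‖ ^ 2) (‖f‖ ^ 2) := by
  have h := RCLike.hasSum_re ℂ (hasSum_co_inner f f)
  simp only [inner_self_eq_norm_sq] at h
  refine h.congr_fun fun k => ?_
  rw [RCLike.conj_mul]; norm_cast

lemma exists_co (c : Lat → ℂ) (hc : Summable fun k => ‖c k‖ ^ 2) : ∃ f : EE, ∀ k, co f k = c k := by
  have : Memℓp c 2 := by
    apply memℓp_gen
    simpa using hc
  refine ⟨mFourierBasis.repr.symm ⟨c, this⟩, fun k => ?_⟩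
  simp [co]

lemma co_eq (f : EE) (k : Lat) : co f k = mFourierCoeff f k := mFourierBasis_repr f k

lemma co_toLp {f : Tor → ℂ} (hf : MemLp f 2 volume) (k : Lat) :
    co (hf.toLp f) k = mFourierCoeff f k := by
  rw [co_eq]
  apply integral_congr_ae
  filter_upwards [hf.coeFn_toLp] with x hx
  rw [hx]

lemma uniq {f : Tor → ℂ} (hf : Integrable f volume) (h0 : ∀ k, mFourierCoeff f k = 0) :
    f =ᵐ[volume] 0 := by
  -- integrals against continuous functions vanish
  have key : ∀ g : C(Tor, ℂ), ∫ x, g x * f x = 0 := by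
    have hint : ∀ g : C(Tor, ℂ), Integrable (fun x => g x * f x) volume := fun g =>
      hf.bdd_mul (c := ‖g‖) g.continuous.aestronglyMeasurable
        (Eventually.of_forall fun x => g.norm_coe_le_norm x)
    let Λ : C(Tor, ℂ) →L[ℂ] ℂ := LinearMap.mkContinuous
      { toFun := fun g => ∫ x, g x * f x
        map_add' := fun g h => by
          simp only [ContinuousMap.add_apply, add_mul]
          exact integral_add (hint g) (hint h)
        map_smul' := fun c g => by
          simp only [ContinuousMap.smul_apply, smul_eq_mul, mul_assoc, RingHom.id_apply]
          exact integral_const_mul _ _ } (∫ x, ‖f x‖) (fun g => by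
        simp only [LinearMap.coe_mk, AddHom.coe_mk]
        rw [mul_comm, ← integral_const_mul]
        refine norm_integral_le_of_norm_le (hf.norm.const_mul _) (Eventually.of_forall fun x => ?_)
        rw [norm_mul]
        exact mul_le_mul_of_nonneg_right (g.norm_coe_le_norm x) (norm_nonneg _))
    have hker : (Submodule.span ℂ (Set.range (mFourier (d := Fin 3)))).topologicalClosure
        ≤ LinearMap.ker Λ.toLinearMap := by
      apply Submodule.topologicalClosure_minimal
      · rw [Submodule.span_le]
        rintro _ ⟨n, rfl⟩
        have := h0 (-n)
        simp only [mFourierCoeff, neg_neg, smul_eq_mul] at this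
        exact this
      · exact Λ.isClosed_ker
    rw [span_mFourier_closure_eq_top] at hker
    intro g
    exact hker (Submodule.mem_top (x := g))
  apply ae_eq_zero_of_forall_setIntegral_isClosed_eq_zero hf
  intro s hs
  -- approximate indicator
  have hlim : Tendsto (fun n : ℕ => ∫ x, ((thickenedIndicator (Nat.one_div_pos_of_nat (α := ℝ) (n := n)) s x : ℝ) : ℂ) * f x) atTop
      (𝓝 (∫ x, s.indicator f x)) := by
    apply tendsto_integral_of_dominated_convergence (fun x => ‖f x‖)
    · intro n
      refine AEStronglyMeasurable.mul ?_ hf.1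
      exact (Complex.continuous_ofReal.comp (NNReal.continuous_coe.comp (thickenedIndicator _ s).continuous)).aestronglyMeasurable
    · exact hf.norm
    · intro n
      refine Eventually.of_forall fun x => ?_
      rw [norm_mul]
      refine mul_le_of_le_one_left (norm_nonneg _) ?_
      rw [Complex.norm_real, Real.norm_of_nonneg (NNReal.coe_nonneg _)]
      exact_mod_cast thickenedIndicator_le_one _ s x
    · refine Eventually.of_forall fun x => ?_
      have h1 := thickenedIndicator_tendsto_indicator_closure
        (fun n => Nat.one_div_pos_of_nat (α := ℝ) (n := n)) tendsto_one_div_add_atTop_nhds_zero_nat s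
      rw [tendsto_pi_nhds] at h1
      have h2 := h1 x
      rw [hs.closure_eq] at h2
      have h3 := ((Complex.continuous_ofReal.comp NNReal.continuous_coe).tendsto _).comp h2
      have h4 := h3.mul_const (f x)
      have e5 : s.indicator f x = (Complex.ofReal ∘ NNReal.toReal) (s.indicator (fun _ => 1) x) * f x := by
        by_cases hx : x ∈ s <;> simp [hx]
      rw [e5]
      exact h4
  have hz : ∀ n : ℕ, ∫ x, ((thickenedIndicator (Nat.one_div_pos_of_nat (α := ℝ) (n := n)) s x : ℝ) : ℂ) * f x = 0 := by
    intro n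
    exact key ⟨fun x => ((thickenedIndicator (Nat.one_div_pos_of_nat (α := ℝ) (n := n)) s x : ℝ) : ℂ),
      Complex.continuous_ofReal.comp (NNReal.continuous_coe.comp (thickenedIndicator _ s).continuous)⟩
  rw [← integral_indicator hs.measurableSet]
  simp only [hz] at hlim
  exact (tendsto_nhds_unique hlim tendsto_const_nhds)

lemma memLp_of_coeff {f : Tor → ℂ} (hf : Integrable f volume)
    (hs : Summable fun k => ‖mFourierCoeff f k‖ ^ 2) : MemLp f 2 volume := by
  obtain ⟨h, hh⟩ := exists_co _ hs
  have hmem := Lp.memLp h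
  have hint : Integrable h volume := hmem.integrable (by norm_num)
  have hsub : (fun x => f x - h x) =ᵐ[volume] 0 := by
    apply uniq (hf.sub hint)
    intro k
    have e : mFourierCoeff (fun x => f x - h x) k = mFourierCoeff f k - mFourierCoeff h k := by
      unfold mFourierCoeff
      rw [← integral_sub]
      · simp only [smul_sub]
      · exact hf.bdd_smul 1 (mFourier (-k)).continuous.aestronglyMeasurable
          (Eventually.of_forall fun x => ((mFourier (-k)).norm_coe_le_norm x).trans mFourier_norm.le)
      · exact hint.bdd_smul 1 (mFourier (-k)).continuous.aestronglyMeasurable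
          (Eventually.of_forall fun x => ((mFourier (-k)).norm_coe_le_norm x).trans mFourier_norm.le)
    change mFourierCoeff (fun x => f x - h x) k = 0
    rw [e, ← co_eq, hh, sub_self]
  refine hmem.ae_eq ?_
  filter_upwards [hsub] with x hx
  exact (sub_eq_zero.1 hx).symm

/-- multiplication by a bounded real function -/
def mulE (B : Tor → ℝ) (f : EE) : EE :=
  open Classical in
  if h : MemLp (fun x => (B x : ℂ) * f x) 2 volume then h.toLp _ else 0

/-- bounded measurable -/
def Bdd (B : Tor → ℝ) (M : ℝ) : Prop := AEStronglyMeasurable B volume ∧ ∀ x, |B x| ≤ M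

lemma Bdd.memLp {B : Tor → ℝ} {M : ℝ} (h : Bdd B M) (f : EE) :
    MemLp (fun x => (B x : ℂ) * f x) 2 volume := by
  refine MemLp.of_le_mul (c := M) (Lp.memLp f) ?_ (Eventually.of_forall fun x => ?_)
  · exact (Complex.continuous_ofReal.comp_aestronglyMeasurable h.1).mul (Lp.aestronglyMeasurable f)
  · rw [norm_mul, Complex.norm_real]
    exact mul_le_mul_of_nonneg_right (h.2 x) (norm_nonneg _)

lemma Bdd.coeFn {B : Tor → ℝ} {M : ℝ} (h : Bdd B M) (f : EE) :
    mulE B f =ᵐ[volume] fun x => (B x : ℂ) * f x := by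
  unfold mulE
  rw [dif_pos (h.memLp f)]
  exact (h.memLp f).coeFn_toLp

lemma Bdd.norm_le {B : Tor → ℝ} {M : ℝ} (h : Bdd B M) (f : EE) : ‖mulE B f‖ ≤ M * ‖f‖ := by
  refine Lp.norm_le_mul_norm_of_ae_le_mul ?_
  filter_upwards [h.coeFn f] with x hx
  rw [hx, norm_mul, Complex.norm_real]
  exact mul_le_mul_of_nonneg_right (h.2 x) (norm_nonneg _)

lemma Bdd.coercive {B : Tor → ℝ} {M β : ℝ} (h : Bdd B M) (hβ : ∀ x, β ≤ B x) (f : EE) :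
    β * ‖f‖ ^ 2 ≤ (inner ℂ f (mulE B f)).re := by
  have e1 : ‖f‖ ^ 2 = ∫ x, ‖f x‖ ^ 2 := by
    rw [← (hasSum_co_sq f).tsum_eq, ← (hasSum_sq_mFourierCoeff f).tsum_eq]
    simp only [co_eq]
  have i1 : Integrable (fun x => ‖f x‖ ^ 2) volume := (Lp.memLp f).integrable_norm_pow (by norm_num)
  have e2 : (inner ℂ f (mulE B f)).re = ∫ x, B x * ‖f x‖ ^ 2 := by
    rw [L2.inner_def]
    have : ∀ᵐ x ∂(volume : Measure Tor), inner ℂ (f x) (mulE B f x) = ((B x * ‖f x‖ ^ 2 : ℝ) : ℂ) := by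
      filter_upwards [h.coeFn f] with x hx
      rw [hx, RCLike.inner_apply, mul_assoc, Complex.mul_conj, Complex.normSq_eq_norm_sq]
      push_cast; ring
    rw [integral_congr_ae this, integral_complex_ofReal, Complex.ofReal_re]
  rw [e1, e2, ← integral_const_mul]
  refine integral_mono (i1.const_mul _) ?_ fun x => mul_le_mul_of_nonneg_right (hβ x) (by positivity)
  exact i1.bdd_mul (c := M) h.1 (Eventually.of_forall h.2)

lemma Bdd.hasSum {B : Tor → ℝ} {M : ℝ} (h : Bdd B M) (f : EE) (k : Lat) :
    HasSum (fun m : Lat => mFourierCoeff (fun x => (B x : ℂ)) (fun a => k a - m a) * co f m)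
      (co (mulE B f) k) := by
  have hs := hasSum_co_inner (mulE B (mFourierLp 2 k)) f
  have e : inner ℂ (mulE B (mFourierLp 2 k)) f = co (mulE B f) k := by
    rw [co, HilbertBasis.repr_apply_apply, coe_mFourierBasis, L2.inner_def, L2.inner_def]
    apply integral_congr_ae
    filter_upwards [h.coeFn f, h.coeFn (mFourierLp 2 k)] with x h1 h2
    rw [h1, h2]
    simp only [RCLike.inner_apply, map_mul, Complex.conj_ofReal]
    ring
  rw [e] at hs
  refine hs.congr_fun fun m => ?_
  congr 1
  rw [co_eq]
  unfold mFourierCoeff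
  rw [← integral_conj]
  apply integral_congr_ae
  filter_upwards [h.coeFn (mFourierLp 2 k), coeFn_mFourierLp 2 k] with x h1 h2
  rw [h1, h2]
  have : (-fun a => k a - m a : Lat) = m + -k := by
    ext a; simp [sub_eq_add_neg]
  rw [this, mFourier_add]
  simp only [smul_eq_mul, map_mul, Complex.conj_ofReal, mFourier_neg, Complex.conj_conj]
  ring

lemma mulE_sub {B₁ B₂ : Tor → ℝ} {M₁ M₂ M₃ : ℝ} (h₁ : Bdd B₁ M₁) (h₂ : Bdd B₂ M₂)
    (h₃ : Bdd (fun x => B₁ x - B₂ x) M₃) (f₁ f₂ : EE) :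
    mulE B₁ f₁ - mulE B₂ f₂ = mulE B₁ (f₁ - f₂) + mulE (fun x => B₁ x - B₂ x) f₂ := by
  apply Lp.ext
  filter_upwards [Lp.coeFn_sub (mulE B₁ f₁) (mulE B₂ f₂),
    Lp.coeFn_add (mulE B₁ (f₁ - f₂)) (mulE (fun x => B₁ x - B₂ x) f₂),
    h₁.coeFn f₁, h₂.coeFn f₂, h₁.coeFn (f₁ - f₂), h₃.coeFn f₂, Lp.coeFn_sub f₁ f₂] with x a b c d e f g
  rw [a, b]
  simp only [Pi.sub_apply, Pi.add_apply, c, d, e, f, g]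
  push_cast; ring

lemma co_sub (f g : EE) (k : Lat) : co (f - g) k = co f k - co g k := by
  simp [co]

lemma energy (ξ : Lat → Fin 3 → ℝ) (α : ℝ) (v g : EE) (c p : Fin 3 → EE)
    (hc : ∀ a k, co (c a) k = (ξ k a : ℂ) * co v k)
    (heq : ∀ k, ((α ^ 2 : ℝ) : ℂ) * ∑ a, (ξ k a : ℂ) * co (p a) k + co v k = co g k) :
    α ^ 2 * ∑ a, (inner ℂ (c a) (p a)).re + ‖v‖ ^ 2 = (inner ℂ v g).re := by
  have h1 : HasSum (fun k => ((α ^ 2 : ℝ) : ℂ) * ∑ a, conj (co (c a) k) * co (p a) k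
      + conj (co v k) * co v k)
      (((α ^ 2 : ℝ) : ℂ) * ∑ a, inner ℂ (c a) (p a) + inner ℂ v v) :=
    ((hasSum_sum fun a _ => hasSum_co_inner (c a) (p a)).mul_left _).add (hasSum_co_inner v v)
  have h2 := hasSum_co_inner v g
  have e : (fun k => ((α ^ 2 : ℝ) : ℂ) * ∑ a, conj (co (c a) k) * co (p a) k
      + conj (co v k) * co v k) = fun k => conj (co v k) * co g k := by
    funext k
    rw [← heq k]
    simp only [hc, map_mul, Complex.conj_ofReal, mul_add, Finset.mul_sum]
    congr 1
    refine Finset.sum_congr rfl fun a _ => ?_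
    ring
  rw [e] at h1
  have h3 := h1.unique h2
  have h4 := congrArg Complex.re h3
  rw [← h4, Complex.add_re, Complex.re_ofReal_mul, Complex.re_sum]
  congr 1
  exact (inner_self_eq_norm_sq (𝕜 := ℂ) v).symm

lemma lift_data (ξ : Lat → Fin 3 → ℝ) (v : Lat → ℂ)
    (hv : Summable fun k => (1 + ∑ a, ξ k a ^ 2) * ‖v k‖ ^ 2) :
    ∃ (V : EE) (c : Fin 3 → EE), (∀ k, co V k = v k) ∧ (∀ a k, co (c a) k = (ξ k a : ℂ) * v k) := by
  have h0 : ∀ k, 0 ≤ ∑ a, ξ k a ^ 2 := fun k => Finset.sum_nonneg fun a _ => sq_nonneg _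
  obtain ⟨V, hV⟩ := exists_co v (hv.of_nonneg_of_le (fun k => by positivity) fun k => by
    nlinarith [h0 k, mul_nonneg (h0 k) (sq_nonneg ‖v k‖)])
  have : ∀ a, ∃ f : EE, ∀ k, co f k = (ξ k a : ℂ) * v k := fun a =>
    exists_co _ (hv.of_nonneg_of_le (fun k => by positivity) fun k => by
      rw [norm_mul, mul_pow, Complex.norm_real, Real.norm_eq_abs, sq_abs]
      refine mul_le_mul_of_nonneg_right ?_ (by positivity)
      have := Finset.single_le_sum (f := fun a => ξ k a ^ 2) (fun a _ => sq_nonneg _) (Finset.mem_univ a)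
      linarith)
  choose c hc using this
  exact ⟨V, c, hV, hc⟩

lemma eq_lift (ξ : Lat → Fin 3 → ℝ) {B : Tor → ℝ} {M : ℝ} (hB : Bdd B M) (v : Lat → ℂ)
    (c : Fin 3 → EE) (hc : ∀ a k, co (c a) k = (ξ k a : ℂ) * v k) (k : Lat) :
    ∑' m : Lat, ((∑ a, ξ k a * ξ m a : ℝ) : ℂ) *
        mFourierCoeff (fun x => (B x : ℂ)) (fun a => k a - m a) * v m
      = ∑ a, (ξ k a : ℂ) * co (mulE B (c a)) k := by
  have h := hasSum_sum (s := Finset.univ) fun a _ => (hB.hasSum (c a) k).mul_left (ξ k a : ℂ)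
  rw [← h.tsum_eq]
  refine tsum_congr fun m => ?_
  simp only [hc]
  push_cast
  rw [Finset.sum_mul, Finset.sum_mul]
  refine Finset.sum_congr rfl fun a _ => ?_
  ring

lemma hasSum_H1 (ξ : Lat → Fin 3 → ℝ) (v : Lat → ℂ) (V : EE) (c : Fin 3 → EE)
    (hV : ∀ k, co V k = v k) (hc : ∀ a k, co (c a) k = (ξ k a : ℂ) * v k) :
    HasSum (fun k => (1 + ∑ a, ξ k a ^ 2) * ‖v k‖ ^ 2) (‖V‖ ^ 2 + ∑ a, ‖c a‖ ^ 2) := by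
  have h := (hasSum_co_sq V).add (hasSum_sum (s := Finset.univ) fun a _ => hasSum_co_sq (c a))
  refine h.congr_fun fun k => ?_
  simp only [hV, hc, norm_mul, mul_pow, Complex.norm_real, Real.norm_eq_abs, sq_abs]
  rw [add_mul, one_mul, Finset.sum_mul]

lemma real_ineq {μ x y e : ℝ} (hμ : 0 < μ) (hx : 0 ≤ x)  (h : μ * x ^ 2 ≤ y * x + e * x) (hy : 0 ≤ y) (he : 0 ≤ e) :
    x ≤ 1 / μ * (y + e) := by
  rw [div_mul_eq_mul_div, one_mul, le_div_iff₀ hμ]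
  rcases hx.eq_or_lt with h0 | h0
  · rw [← h0]; simp; positivity
  · nlinarith

lemma real_final {α β δ N s W s₂ G N₂ : ℝ} (hα : 0 < α) (hβ : 0 < β) (hδ : 0 ≤ δ) (hN : 0 ≤ N)
    (hs0 : 0 ≤ s) (hW : 0 ≤ W) (hs20 : 0 ≤ s₂) (hG : 0 ≤ G)
    (F₂ : α ^ 2 * (β * s₂ ^ 2) + N₂ ^ 2 ≤ N₂ * G)
    (F : α ^ 2 * (β * s ^ 2) + N ^ 2 ≤ N * W + α ^ 2 * δ * s₂ * s) :
    √(N ^ 2 + s ^ 2) ≤ K0c α β * W + K0c α β ^ ((3 : ℝ) / 2) * α ^ 2 * δ * G := by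
  obtain ⟨μ, hμ⟩ : ∃ μ, μ = min (α ^ 2 * β) 1 := ⟨_, rfl⟩
  have hμ0 : 0 < μ := hμ ▸ lt_min (by positivity) one_pos
  have hμ1 : μ ≤ 1 := hμ ▸ min_le_right _ _
  have hμ2 : μ ≤ α ^ 2 * β := hμ ▸ min_le_left _ _
  have hμα : μ * s₂ ^ 2 ≤ α ^ 2 * (β * s₂ ^ 2) := by
    rw [← mul_assoc]; exact mul_le_mul_of_nonneg_right hμ2 (by positivity)
  have F₂' : μ * s₂ ^ 2 ≤ G ^ 2 := by
    nlinarith [sq_nonneg (N₂ - G), sq_nonneg (N₂), sq_nonneg (G)]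
  have F₂'' : s₂ ≤ √(1 / μ) * G := by
    rw [← Real.sqrt_sq hs20, ← Real.sqrt_sq hG, ← Real.sqrt_mul (by positivity)]
    apply Real.sqrt_le_sqrt
    rw [div_mul_eq_mul_div, one_mul, le_div_iff₀ hμ0]
    linarith
  obtain ⟨X, hXd⟩ : ∃ X, X = √(N ^ 2 + s ^ 2) := ⟨_, rfl⟩
  rw [← hXd]
  have hX2 : X ^ 2 = N ^ 2 + s ^ 2 := hXd ▸ Real.sq_sqrt (by positivity)
  have hX0 : 0 ≤ X := hXd ▸ Real.sqrt_nonneg _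
  have hVX : N ≤ X := hXd ▸ Real.le_sqrt_of_sq_le (by nlinarith)
  have hsX : s ≤ X := hXd ▸ Real.le_sqrt_of_sq_le (by nlinarith [sq_nonneg N])
  have main : X ≤ 1 / μ * (W + α ^ 2 * δ * s₂) := by
    apply real_ineq hμ0 hX0 _ hW (by positivity)
    have i1 : μ * X ^ 2 ≤ α ^ 2 * (β * s ^ 2) + N ^ 2 := by
      rw [hX2]
      nlinarith [mul_le_mul_of_nonneg_right hμ2 (sq_nonneg s), mul_le_mul_of_nonneg_right hμ1 (sq_nonneg N)]
    have i2 : N * W ≤ W * X := by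
      rw [mul_comm]; exact mul_le_mul_of_nonneg_left hVX hW
    have i3 : α ^ 2 * δ * s₂ * s ≤ α ^ 2 * δ * s₂ * X := mul_le_mul_of_nonneg_left hsX (by positivity)
    linarith
  have hK : K0c α β = 1 / μ := by rw [hμ]; rfl
  rw [hK]
  have hp : (1 / μ) ^ ((3 : ℝ) / 2) = 1 / μ * √(1 / μ) := by
    rw [show (3 : ℝ) / 2 = 1 + 1 / 2 by norm_num, Real.rpow_add (by positivity), Real.rpow_one,
      Real.sqrt_eq_rpow]
  rw [hp]
  refine main.trans ?_
  have j : α ^ 2 * δ * s₂ ≤ α ^ 2 * δ * (√(1 / μ) * G) := mul_le_mul_of_nonneg_left F₂'' (by positivity)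
  have j2 := mul_le_mul_of_nonneg_left j (show 0 ≤ 1 / μ by positivity)
  linarith

set_option maxHeartbeats 2000000 in
theorem scalar_est (ξ : Lat → Fin 3 → ℝ) {α β δ : ℝ} (hα : 0 < α) (hβ : 0 < β) (hδ : 0 ≤ δ)
    {B₁ B₂ : Tor → ℝ} (m₁ : AEStronglyMeasurable B₁ volume) (m₂ : AEStronglyMeasurable B₂ volume)
    (b₁ : ∀ x, β ≤ B₁ x ∧ B₁ x ≤ 1) (b₂ : ∀ x, β ≤ B₂ x ∧ B₂ x ≤ 1)
    (hd : ∀ x, |B₁ x - B₂ x| ≤ δ) (v₁ v₂ g₁ g₂ : Lat → ℂ)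
    (hv₁ : Summable fun k => (1 + ∑ a, ξ k a ^ 2) * ‖v₁ k‖ ^ 2)
    (hv₂ : Summable fun k => (1 + ∑ a, ξ k a ^ 2) * ‖v₂ k‖ ^ 2)
    (hg₁ : Summable fun k => ‖g₁ k‖ ^ 2) (hg₂ : Summable fun k => ‖g₂ k‖ ^ 2)
    (e₁ : ∀ k, ((α ^ 2 : ℝ) : ℂ) * ∑' m : Lat, ((∑ a, ξ k a * ξ m a : ℝ) : ℂ) *
        mFourierCoeff (fun x => (B₁ x : ℂ)) (fun a => k a - m a) * v₁ m + v₁ k = g₁ k)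
    (e₂ : ∀ k, ((α ^ 2 : ℝ) : ℂ) * ∑' m : Lat, ((∑ a, ξ k a * ξ m a : ℝ) : ℂ) *
        mFourierCoeff (fun x => (B₂ x : ℂ)) (fun a => k a - m a) * v₂ m + v₂ k = g₂ k) :
    (Summable fun k => (1 + ∑ a, ξ k a ^ 2) * ‖v₁ k - v₂ k‖ ^ 2) ∧
    (Summable fun k => ‖g₁ k - g₂ k‖ ^ 2) ∧
    √(∑' k, (1 + ∑ a, ξ k a ^ 2) * ‖v₁ k - v₂ k‖ ^ 2) ≤
      K0c α β * √(∑' k, ‖g₁ k - g₂ k‖ ^ 2) +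
        K0c α β ^ ((3 : ℝ) / 2) * α ^ 2 * δ * √(∑' k, ‖g₂ k‖ ^ 2) := by
  have hB₁ : Bdd B₁ 1 := ⟨m₁, fun x => abs_le.2 ⟨by linarith [(b₁ x).1], (b₁ x).2⟩⟩
  have hB₂ : Bdd B₂ 1 := ⟨m₂, fun x => abs_le.2 ⟨by linarith [(b₂ x).1], (b₂ x).2⟩⟩
  have hD : Bdd (fun x => B₁ x - B₂ x) δ := ⟨m₁.sub m₂, hd⟩
  obtain ⟨V₁, c₁, hV₁, hc₁⟩ := lift_data ξ v₁ hv₁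
  obtain ⟨V₂, c₂, hV₂, hc₂⟩ := lift_data ξ v₂ hv₂
  obtain ⟨G₁, hG₁⟩ := exists_co g₁ hg₁
  obtain ⟨G₂, hG₂⟩ := exists_co g₂ hg₂
  simp only [eq_lift ξ hB₁ v₁ c₁ hc₁] at e₁
  simp only [eq_lift ξ hB₂ v₂ c₂ hc₂] at e₂
  have E₂ := energy ξ α V₂ G₂ c₂ (fun a => mulE B₂ (c₂ a)) (fun a k => by rw [hc₂, hV₂])
    (fun k => by rw [hV₂, hG₂]; exact e₂ k)
  have E := energy ξ α (V₁ - V₂) (G₁ - G₂) (fun a => c₁ a - c₂ a)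
    (fun a => mulE B₁ (c₁ a) - mulE B₂ (c₂ a))
    (fun a k => by rw [co_sub, co_sub, hc₁, hc₂, hV₁, hV₂]; ring)
    (fun k => by
      rw [co_sub, co_sub, hV₁, hV₂, hG₁, hG₂, ← e₁ k, ← e₂ k]
      simp only [co_sub, mul_sub, Finset.sum_sub_distrib]
      ring)
  have S := hasSum_H1 ξ (fun k => v₁ k - v₂ k) (V₁ - V₂) (fun a => c₁ a - c₂ a)
    (fun k => by rw [co_sub, hV₁, hV₂]) (fun a k => by rw [co_sub, hc₁, hc₂]; ring)
  have SG := hasSum_co_sq (G₁ - G₂)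
  simp only [co_sub, hG₁, hG₂] at SG
  have SG₂ := hasSum_co_sq G₂
  simp only [hG₂] at SG₂
  refine ⟨S.summable, SG.summable, ?_⟩
  rw [S.tsum_eq, SG.tsum_eq, SG₂.tsum_eq, Real.sqrt_sq (norm_nonneg _), Real.sqrt_sq (norm_nonneg _)]
  clear S SG SG₂ e₁ e₂
  generalize hw : G₁ - G₂ = w at *
  generalize hV : V₁ - V₂ = V at *
  -- estimate of `c₂`
  obtain ⟨s₂, hs₂⟩ : ∃ s, s = √(∑ a, ‖c₂ a‖ ^ 2) := ⟨_, rfl⟩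
  have hs₂' : s₂ ^ 2 = ∑ a, ‖c₂ a‖ ^ 2 := hs₂ ▸ Real.sq_sqrt (Finset.sum_nonneg fun a _ => by positivity)
  obtain ⟨s, hs⟩ : ∃ s, s = √(∑ a, ‖c₁ a - c₂ a‖ ^ 2) := ⟨_, rfl⟩
  have hs' : s ^ 2 = ∑ a, ‖c₁ a - c₂ a‖ ^ 2 := hs ▸ Real.sq_sqrt (Finset.sum_nonneg fun a _ => by positivity)
  have hs0 : 0 ≤ s := hs ▸ Real.sqrt_nonneg _
  have hs20 : 0 ≤ s₂ := hs₂ ▸ Real.sqrt_nonneg _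
  have re_le : ∀ x y : EE, (inner ℂ x y).re ≤ ‖x‖ * ‖y‖ := fun x y =>
    (Complex.re_le_norm _).trans (norm_inner_le_norm x y)
  have F₂ : α ^ 2 * (β * s₂ ^ 2) + ‖V₂‖ ^ 2 ≤ ‖V₂‖ * ‖G₂‖ := by
    refine le_trans ?_ (re_le V₂ G₂)
    rw [← E₂, hs₂', Finset.mul_sum]
    gcongr with a
    exact hB₂.coercive (fun x => (b₂ x).1) _
  -- main estimate
  have F : α ^ 2 * (β * s ^ 2) + ‖V‖ ^ 2 ≤ ‖V‖ * ‖w‖ + α ^ 2 * δ * s₂ * s := by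
    have CS : ∑ a, ‖c₁ a - c₂ a‖ * ‖c₂ a‖ ≤ s * s₂ := by
      rw [hs, hs₂]
      exact Real.sum_mul_le_sqrt_mul_sqrt Finset.univ (fun a => ‖c₁ a - c₂ a‖) (fun a => ‖c₂ a‖)
    have T1 : ∀ a, β * ‖c₁ a - c₂ a‖ ^ 2 - δ * (‖c₁ a - c₂ a‖ * ‖c₂ a‖) ≤
        (inner ℂ (c₁ a - c₂ a) (mulE B₁ (c₁ a) - mulE B₂ (c₂ a))).re := by
      intro a
      rw [mulE_sub hB₁ hB₂ hD, inner_add_right, Complex.add_re]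
      have t1 := hB₁.coercive (fun x => (b₁ x).1) (c₁ a - c₂ a)
      have t2 : -(‖c₁ a - c₂ a‖ * (δ * ‖c₂ a‖)) ≤
          (inner ℂ (c₁ a - c₂ a) (mulE (fun x => B₁ x - B₂ x) (c₂ a))).re := by
        have t3 := (Complex.abs_re_le_norm _).trans
          (norm_inner_le_norm (𝕜 := ℂ) (c₁ a - c₂ a) (mulE (fun x => B₁ x - B₂ x) (c₂ a)))
        have t4 := mul_le_mul_of_nonneg_left (hD.norm_le (c₂ a)) (norm_nonneg (c₁ a - c₂ a))
        have t5 := (abs_le.1 (t3.trans t4)).1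
        exact t5
      linarith
    have T2 := Finset.sum_le_sum fun a (_ : a ∈ Finset.univ) => T1 a
    rw [Finset.sum_sub_distrib, ← Finset.mul_sum, ← Finset.mul_sum, ← hs'] at T2
    have T3 := mul_le_mul_of_nonneg_left T2 (sq_nonneg α)
    have T4 := mul_le_mul_of_nonneg_left (mul_le_mul_of_nonneg_left CS hδ) (sq_nonneg α)
    have T5 := re_le V w
    nlinarith
  have hX : ‖V‖ ^ 2 + ∑ a, ‖c₁ a - c₂ a‖ ^ 2 = ‖V‖ ^ 2 + s ^ 2 := by rw [hs']
  rw [hX]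
  exact real_final hα hβ hδ (norm_nonneg _) hs0 (norm_nonneg _) hs20 (norm_nonneg _) F₂ F
local instance instNegCircle : Measure.IsNegInvariant (volume : Measure UnitAddCircle) :=
  Measure.IsAddHaarMeasure.isNegInvariant_of_innerRegular _
local instance instNegTor : Measure.IsNegInvariant (volume : Measure Tor) :=
  Measure.pi.isNegInvariant (fun _ : Fin 3 => (volume : Measure UnitAddCircle))

/-- section of the covering of the torus -/
def sec (L : ℝ) (θ : Tor) : Pt :=
  fun i => L * ((measurableEquivPiIoc (fun _ : Fin 3 => (0 : ℝ)) θ).1 i)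

lemma sec_eq (L : ℝ) : sec L = (fun x : Pt => L • x) ∘ Subtype.val ∘
    (measurableEquivPiIoc (fun _ : Fin 3 => (0 : ℝ))) := by
  rfl

lemma sec_coe (L : ℝ) (θ : Tor) (i : Fin 3) :
    ∃ y : ℝ, sec L θ i = L * y ∧ (y : UnitAddCircle) = θ i := by
  refine ⟨_, rfl, ?_⟩
  have := (measurableEquivPiIoc (fun _ : Fin 3 => (0 : ℝ))).symm_apply_apply θ
  rw [coe_symm_measurableEquivPiIoc_apply] at this
  exact congrFun this i

lemma measSet_ioc : MeasurableSet {x : Fin 3 → ℝ | ∀ i, x i ∈ Set.Ioc (0:ℝ) (0 + 1)} :=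
  MeasurableSet.univ_pi' (fun i => measurableSet_Ioc)

lemma sec_emb {L : ℝ} (hL : 0 < L) : MeasurableEmbedding (sec L) := by
  rw [sec_eq]
  refine MeasurableEmbedding.comp (Homeomorph.smulOfNeZero L hL.ne').measurableEmbedding ?_
  exact (MeasurableEmbedding.subtype_coe measSet_ioc).comp (MeasurableEquiv.measurableEmbedding _)

lemma sec_map {L : ℝ} (hL : 0 < L) :
    Measure.map (sec L) volume = ENNReal.ofReal ((L ^ 3)⁻¹) • (volume : Measure Pt).restrict (box L) := by
  have hm : Measurable (fun x : Pt => L • x) := measurable_const_smul L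
  rw [sec_eq, ← Measure.map_map hm (measurable_subtype_coe.comp (MeasurableEquiv.measurable _)),
    ← Measure.map_map measurable_subtype_coe (MeasurableEquiv.measurable _),
    (measurePreserving_equivPiIoc _).map_eq]
  have h1 := map_comap_subtype_coe measSet_ioc (volume : Measure Pt)
  erw [h1]
  have hpre : {x : Fin 3 → ℝ | ∀ i, x i ∈ Set.Ioc (0:ℝ) (0 + 1)} = (fun x : Pt => L • x) ⁻¹'
      (Set.univ.pi fun _ => Set.Ioc (0 : ℝ) L) := by
    ext x
    simp [Set.mem_pi, hL, forall_and]
  have emb : MeasurableEmbedding (fun x : Pt => L • x) :=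
    (Homeomorph.smulOfNeZero L hL.ne').measurableEmbedding
  rw [hpre, ← emb.restrict_map]
  have h2 : Measure.map (fun x : Pt => L • x) (volume : Measure Pt) = ENNReal.ofReal ((L ^ 3)⁻¹) • volume := by
    have := Measure.map_addHaar_smul (volume : Measure Pt) hL.ne'
    simp only [Module.finrank_fin_fun] at this
    rw [abs_of_pos (by positivity)] at this
    exact this
  erw [h2]
  rw [Measure.restrict_smul]
  congr 1
  refine Measure.restrict_congr_set ?_
  rw [box, Set.pi_univ_Icc]
  exact Measure.univ_pi_Ioc_ae_eq_Icc

lemma sec_integral {E : Type*} [NormedAddCommGroup E] [NormedSpace ℝ E] {L : ℝ} (hL : 0 < L) (g : Pt → E) :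
    ∫ θ, g (sec L θ) = (L ^ 3)⁻¹ • ∫ x in box L, g x := by
  rw [← (sec_emb hL).integral_map, sec_map hL, integral_smul_measure,
    ENNReal.toReal_ofReal (by positivity)]

lemma sec_integrable {E : Type*} [NormedAddCommGroup E] {L : ℝ} (hL : 0 < L) {g : Pt → E} (hg : IntegrableOn g (box L)) :
    Integrable (fun θ => g (sec L θ)) volume := by
  have : Integrable g (Measure.map (sec L) volume) := by
    rw [sec_map hL]
    exact hg.smul_measure ENNReal.ofReal_ne_top
  exact (sec_emb hL).integrable_map_iff.1 this

lemma em_sec {L : ℝ} (hL : 0 < L) (k : Lat) (θ : Tor) : em L k (sec L θ) = mFourier (-k) θ := by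
  choose y hy1 hy2 using sec_coe L θ
  have : θ = fun i => (y i : UnitAddCircle) := by ext i; rw [hy2]
  rw [this]
  simp only [mFourier, ContinuousMap.coe_mk, fourier_coe_apply, em, ← Complex.exp_sum]
  congr 1
  have hL' : (L : ℂ) ≠ 0 := by exact_mod_cast hL.ne'
  push_cast
  rw [Finset.mul_sum]
  refine Finset.sum_congr rfl fun i _ => ?_
  rw [← this, hy1]
  simp only [freq, Pi.neg_apply]
  push_cast
  field_simp

lemma fcS_eq {L : ℝ} (hL : 0 < L) (g : Pt → ℝ) (k : Lat) :
    fcS L g k = mFourierCoeff (fun θ => (g (sec L θ) : ℂ)) k := by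
  unfold fcS mFourierCoeff
  rw [← sec_integral hL (fun x => em L k x * (g x : ℂ))]
  simp only [em_sec hL, smul_eq_mul]

/-- covering map -/
def prj (L : ℝ) (x : Pt) : Tor := fun i => ((x i / L : ℝ) : UnitAddCircle)

lemma prj_sec {L : ℝ} (hL : 0 < L) (θ : Tor) : prj L (sec L θ) = θ := by
  choose y hy1 hy2 using sec_coe L θ
  ext i
  rw [prj, hy1, ← hy2 i, mul_div_cancel_left₀ _ hL.ne']

lemma periodic_sec {L : ℝ} (hL : 0 < L) {g : Pt → Vec} (hg : SpacePeriodic L g) (x : Pt) (η : Tor) :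
    g (fun a => x a - sec L η a) = g (sec L (prj L x - η)) := by
  choose y hy1 hy2 using sec_coe L η
  choose z hz1 hz2 using sec_coe L (prj L x - η)
  have : ∀ i, ∃ n : ℤ, x i / L - y i = z i + n := by
    intro i
    have h : ((x i / L - y i : ℝ) : UnitAddCircle) = (z i : UnitAddCircle) := by
      rw [hz2, Pi.sub_apply, ← hy2]; rfl
    rw [← sub_eq_zero, ← AddCircle.coe_sub, AddCircle.coe_eq_zero_iff] at h
    obtain ⟨n, hn⟩ := h
    refine ⟨n, ?_⟩
    rw [zsmul_eq_mul, mul_one] at hn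
    linarith
  choose n hn using this
  rw [← hg (sec L (prj L x - η)) n]
  congr 1
  ext i
  rw [hy1, hz1]
  have := hn i
  field_simp at this
  linarith

lemma memLp_sec {L : ℝ} (hL : 0 < L) {g : Pt → ℝ} (hg : IntegrableOn g (box L))
    (hs : Summable fun k => ‖fcS L g k‖ ^ 2) : MemLp (fun θ => (g (sec L θ) : ℂ)) 2 volume := by
  refine memLp_of_coeff (f := fun θ => (g (sec L θ) : ℂ)) (sec_integrable hL hg).ofReal ?_
  simpa only [fcS_eq hL] using hs

lemma integral_sq_sec {L : ℝ} (hL : 0 < L) {g : Pt → ℝ} (hg : IntegrableOn g (box L))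
    (hs : Summable fun k => ‖fcS L g k‖ ^ 2) : ∫ θ, (g (sec L θ)) ^ 2 = ∑' k, ‖fcS L g k‖ ^ 2 := by
  have hm := memLp_sec hL hg hs
  have h1 := (hasSum_sq_mFourierCoeff (hm.toLp _)).tsum_eq
  simp only [← co_eq, co_toLp hm, ← fcS_eq hL] at h1
  rw [h1]
  apply integral_congr_ae
  filter_upwards [hm.coeFn_toLp] with x hx
  rw [hx, Complex.norm_real, Real.norm_eq_abs, sq_abs]

lemma pconv_eq {L : ℝ} (hL : 0 < L) (φ : Pt → ℝ) {g : Pt → Vec} (hg : SpacePeriodic L g) (x : Pt) (i : Fin 3) :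
    pconv L φ g x i = L ^ 3 * ∫ η, φ (sec L η) * g (sec L (prj L x - η)) i := by
  have := sec_integral hL (fun y => φ y * g (fun a => x a - y a) i)
  simp only [periodic_sec hL hg] at this
  rw [this, smul_eq_mul, ← mul_assoc, mul_inv_cancel₀ (by positivity), one_mul]
  rfl

lemma pconv_meas {L : ℝ} (hL : 0 < L) {φ : Pt → ℝ} {g : Pt → Vec} (hg : SpacePeriodic L g)
    (hgi : IntegrableOn g (box L)) (hφ : IntegrableOn φ (box L)) :
    AEStronglyMeasurable (fun θ => pconv L φ g (sec L θ)) volume := by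
  refine (aemeasurable_pi_iff.2 fun i => AEStronglyMeasurable.aemeasurable ?_).aestronglyMeasurable
  simp only [pconv_eq hL φ hg, prj_sec hL]
  refine AEStronglyMeasurable.const_mul ?_ _
  have h1 : AEStronglyMeasurable (fun η => φ (sec L η)) volume := (sec_integrable hL hφ).1
  have h2 : AEStronglyMeasurable (fun η => g (sec L η) i) volume :=
    (continuous_apply i).comp_aestronglyMeasurable (sec_integrable hL hgi).1
  have h3 := AEStronglyMeasurable.convolution_integrand (ContinuousLinearMap.mul ℝ ℝ) h1 h2
    (μ := (volume : Measure Tor)) (ν := (volume : Measure Tor))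
  exact h3.integral_prod_right'

/-- uniform bound of the difference of convolutions -/
lemma pconv_diff {L : ℝ} (hL : 0 < L) {φ : Pt → ℝ} (hφ : KernelL2 L φ) {g₁ g₂ : Pt → Vec}
    (p₁ : SpacePeriodic L g₁) (p₂ : SpacePeriodic L g₂) (i₁ : IntegrableOn g₁ (box L))
    (i₂ : IntegrableOn g₂ (box L)) (s₁ : ∀ i, Summable fun k => ‖fc L g₁ k i‖ ^ 2)
    (s₂ : ∀ i, Summable fun k => ‖fc L g₂ k i‖ ^ 2)
    (s : ∀ i, Summable fun k => ‖fc L (fun x i => g₁ x i - g₂ x i) k i‖ ^ 2) (x : Pt) (i : Fin 3) :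
    |pconv L φ g₁ x i - pconv L φ g₂ x i| ≤
      kernelL2Norm L φ * √(L ^ 3 * ∑' k, ‖fc L (fun x i => g₁ x i - g₂ x i) k i‖ ^ 2) := by
  have mφ : MemLp (fun η => φ (sec L η)) 2 volume := by
    rw [memLp_two_iff_integrable_sq (sec_integrable hL hφ.2.1).1]
    exact sec_integrable hL hφ.2.2
  have j₁ : IntegrableOn (fun x => g₁ x i) (box L) := i₁.eval i
  have j₂ : IntegrableOn (fun x => g₂ x i) (box L) := i₂.eval i
  have m₁ : MemLp (fun η => g₁ (sec L η) i) 2 volume := by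
    simpa using (memLp_sec hL j₁ (s₁ i)).re
  have m₂ : MemLp (fun η => g₂ (sec L η) i) 2 volume := by
    simpa using (memLp_sec hL j₂ (s₂ i)).re
  have hmp : MeasurePreserving (fun η : Tor => prj L x - η) volume volume :=
    (volume : Measure Tor).measurePreserving_sub_left (prj L x)
  have n₁ := m₁.comp_measurePreserving hmp
  have n₂ := m₂.comp_measurePreserving hmp
  have n := n₁.sub n₂
  have q₁ : Integrable (fun η => φ (sec L η) * g₁ (sec L (prj L x - η)) i) volume :=
    mφ.integrable_mul n₁
  have q₂ : Integrable (fun η => φ (sec L η) * g₂ (sec L (prj L x - η)) i) volume :=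
    mφ.integrable_mul n₂
  rw [pconv_eq hL φ p₁, pconv_eq hL φ p₂, ← mul_sub, ← integral_sub q₁ q₂]
  have H := integral_mul_norm_le_Lp_mul_Lq (μ := (volume : Measure Tor)) (p := 2) (q := 2)
    (f := fun η => φ (sec L η)) (g := fun η => g₁ (sec L (prj L x - η)) i - g₂ (sec L (prj L x - η)) i)
    (by constructor <;> norm_num) (by simpa using mφ) (by simpa using! n)
  have e1 : ∫ η, ‖φ (sec L η)‖ ^ (2:ℝ) = (L ^ 3)⁻¹ * ∫ x in box L, φ x ^ 2 := by
    rw [← smul_eq_mul, ← sec_integral hL (fun x => φ x ^ 2)]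
    simp
  have e2 : ∫ η, ‖g₁ (sec L (prj L x - η)) i - g₂ (sec L (prj L x - η)) i‖ ^ (2:ℝ)
      = ∑' k, ‖fc L (fun x i => g₁ x i - g₂ x i) k i‖ ^ 2 := by
    have := integral_sq_sec hL (g := fun x => g₁ x i - g₂ x i) (j₁.sub j₂) (s i)
    rw [show (∑' k, ‖fc L (fun x i => g₁ x i - g₂ x i) k i‖ ^ 2) = _ from this.symm]
    rw [← integral_sub_left_eq_self (fun θ => (g₁ (sec L θ) i - g₂ (sec L θ) i) ^ 2) volume (prj L x)]
    simp
  rw [e1, e2] at H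
  rw [abs_mul, abs_of_pos (by positivity : 0 < L ^ 3)]
  have H2 : |∫ η, (φ (sec L η) * g₁ (sec L (prj L x - η)) i - φ (sec L η) * g₂ (sec L (prj L x - η)) i)|
      ≤ ∫ η, ‖φ (sec L η)‖ * ‖g₁ (sec L (prj L x - η)) i - g₂ (sec L (prj L x - η)) i‖ := by
    refine (abs_integral_le_integral_abs).trans (le_of_eq ?_)
    congr 1
    ext η
    rw [← mul_sub, abs_mul]; rfl
  refine (mul_le_mul_of_nonneg_left (H2.trans H) (by positivity)).trans (le_of_eq ?_)
  rw [← Real.sqrt_eq_rpow, ← Real.sqrt_eq_rpow, kernelL2Norm, Real.sqrt_mul (by positivity),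
    Real.sqrt_mul (by positivity), Real.sqrt_inv]
  have : √(L ^ 3) * √(L ^ 3) = L ^ 3 := Real.mul_self_sqrt (by positivity)
  have h0 : √(L ^ 3) ≠ 0 := by positivity
  field_simp
  rw [sq, this]

lemma fc_sub {L : ℝ} (hL : 0 < L) {g₁ g₂ : Pt → Vec} (i₁ : IntegrableOn g₁ (box L))
    (i₂ : IntegrableOn g₂ (box L)) (k : Lat) (i : Fin 3) :
    fc L (fun x i => g₁ x i - g₂ x i) k i = fc L g₁ k i - fc L g₂ k i := by
  unfold fc
  rw [fcS_eq hL, fcS_eq hL, fcS_eq hL]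
  have h₁ : Integrable (fun θ => ((g₁ (sec L θ) i : ℝ) : ℂ)) volume :=
    (sec_integrable hL (g := fun x => g₁ x i) (i₁.eval i)).ofReal
  have h₂ : Integrable (fun θ => ((g₂ (sec L θ) i : ℝ) : ℂ)) volume :=
    (sec_integrable hL (g := fun x => g₂ x i) (i₂.eval i)).ofReal
  unfold mFourierCoeff
  rw [← integral_sub]
  · simp only [← smul_sub, Complex.ofReal_sub]
  · exact h₁.bdd_smul 1 (mFourier (-k)).continuous.aestronglyMeasurable
      (Eventually.of_forall fun x => ((mFourier (-k)).norm_coe_le_norm x).trans mFourier_norm.le)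
  · exact h₂.bdd_smul 1 (mFourier (-k)).continuous.aestronglyMeasurable
      (Eventually.of_forall fun x => ((mFourier (-k)).norm_coe_le_norm x).trans mFourier_norm.le)

lemma hom_comp {L : ℝ} {g : Pt → Vec} (h : homSummable L 0 g) (i : Fin 3) :
    Summable fun k => ‖fc L g k i‖ ^ 2 := by
  refine Summable.of_nonneg_of_le (fun k => by positivity) (fun k => ?_) h
  rw [Real.rpow_zero, one_mul, cnormSq, ← Complex.normSq_eq_norm_sq]
  exact Finset.single_le_sum (f := fun i => Complex.normSq (fc L g k i))
    (fun j _ => Complex.normSq_nonneg _) (Finset.mem_univ i)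

lemma homSq_eq {L : ℝ} {g : Pt → Vec} (h : ∀ i, Summable fun k => ‖fc L g k i‖ ^ 2) :
    homSobSq L 0 g = ∑ i, L ^ 3 * ∑' k, ‖fc L g k i‖ ^ 2 := by
  unfold homSobSq
  rw [← Finset.mul_sum, ← Summable.tsum_finsetSum fun i _ => h i]
  simp only [Real.rpow_zero, one_mul, cnormSq, Complex.normSq_eq_norm_sq]

lemma sob_comp {L : ℝ} {g : Pt → Vec} (h : sobSummable L 1 g) (i : Fin 3) :
    Summable fun k => (1 + ∑ a, freq L k a ^ 2) * ‖fc L g k i‖ ^ 2 := by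
  refine Summable.of_nonneg_of_le (fun k => by positivity) (fun k => ?_) h
  rw [Real.rpow_one, cnormSq, ← Complex.normSq_eq_norm_sq]
  refine mul_le_mul_of_nonneg_left ?_ (by positivity)
  exact Finset.single_le_sum (f := fun i => Complex.normSq (fc L g k i))
    (fun j _ => Complex.normSq_nonneg _) (Finset.mem_univ i)

lemma sobSq_eq {L : ℝ} {g : Pt → Vec}
    (h : ∀ i, Summable fun k => (1 + ∑ a, freq L k a ^ 2) * ‖fc L g k i‖ ^ 2) :
    sobSq L 1 g = ∑ i, L ^ 3 * ∑' k, (1 + ∑ a, freq L k a ^ 2) * ‖fc L g k i‖ ^ 2 := by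
  unfold sobSq
  rw [← Finset.mul_sum, ← Summable.tsum_finsetSum fun i _ => h i]
  simp only [Real.rpow_one, cnormSq, Complex.normSq_eq_norm_sq, freqNormSq, Finset.mul_sum]

lemma comp_le_hom {L : ℝ} (hL : 0 < L) {g : Pt → Vec} (h : ∀ i, Summable fun k => ‖fc L g k i‖ ^ 2)
    (i : Fin 3) : L ^ 3 * ∑' k, ‖fc L g k i‖ ^ 2 ≤ homSobSq L 0 g := by
  rw [homSq_eq h]
  exact Finset.single_le_sum (f := fun i => L ^ 3 * ∑' k, ‖fc L g k i‖ ^ 2)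
    (fun j _ => mul_nonneg (by positivity) (tsum_nonneg fun k => by positivity)) (Finset.mem_univ i)

theorem main_est {L α β CA : ℝ} {A : Vec → ℝ} {φ : Pt → ℝ} {u₁ u₂ w₁ w₂ : Pt → Vec}
    (hL : 0 < L) (hα : 0 < α) (hβ : 0 < β) (hA : IndicatorBounds β A) (hCA : 0 ≤ CA)
    (hlip : ∀ x y : Vec, |A x - A y| ≤ CA * ‖x - y‖) (hφ : KernelL2 L φ)
    (hu₁ : MemL2s L u₁) (hu₂ : MemL2s L u₂) (hw₁ : MemHs L 1 w₁) (hw₂ : MemHs L 1 w₂)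
    (f₁ : FilterEq L α (fun x => A (pconv L φ u₁ x)) w₁ u₁)
    (f₂ : FilterEq L α (fun x => A (pconv L φ u₂ x)) w₂ u₂) :
    √(sobSq L 1 fun x i => w₁ x i - w₂ x i) ≤ 2 * K1c L α β CA φ * (√(homSobSq L 0 u₂) + 1) *
      √(homSobSq L 0 fun x i => u₁ x i - u₂ x i) := by
  obtain ⟨p₁, i₁, -, -, s₁⟩ := hu₁
  obtain ⟨p₂, i₂, -, -, s₂⟩ := hu₂
  obtain ⟨-, j₁, -, r₁⟩ := hw₁
  obtain ⟨-, j₂, -, r₂⟩ := hw₂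
  have hcont : Continuous A := by
    have : LipschitzWith CA.toNNReal A := LipschitzWith.of_dist_le_mul fun x y => by
      rw [Real.coe_toNNReal _ hCA, Real.dist_eq, dist_eq_norm]
      exact hlip x y
    exact this.continuous
  set W := √(homSobSq L 0 fun x i => u₁ x i - u₂ x i) with hW
  set U := √(homSobSq L 0 u₂) with hU
  set N := kernelL2Norm L φ with hN
  have hN0 : 0 ≤ N := Real.sqrt_nonneg _
  have hW0 : 0 ≤ W := Real.sqrt_nonneg _
  have hU0 : 0 ≤ U := Real.sqrt_nonneg _
  have hK0 : 0 < K0c α β := by unfold K0c; positivity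
  have sc₁ := hom_comp s₁
  have sc₂ := hom_comp s₂
  have m₁ : AEStronglyMeasurable (fun θ => A (pconv L φ u₁ (sec L θ))) volume :=
    hcont.comp_aestronglyMeasurable (pconv_meas hL p₁ i₁ hφ.2.1)
  have m₂ : AEStronglyMeasurable (fun θ => A (pconv L φ u₂ (sec L θ))) volume :=
    hcont.comp_aestronglyMeasurable (pconv_meas hL p₂ i₂ hφ.2.1)
  -- summability of differences
  have E₁ : ∀ (i : Fin 3) (k : Lat), ((α ^ 2 : ℝ) : ℂ) * ∑' m : Lat,
      ((∑ a, freq L k a * freq L m a : ℝ) : ℂ) *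
        mFourierCoeff (fun θ => ((A (pconv L φ u₁ (sec L θ)) : ℝ) : ℂ)) (fun a => k a - m a) *
          fc L w₁ m i + fc L w₁ k i = fc L u₁ k i := by
    intro i k
    have := f₁ k i
    simp only [filterLHS, fcS_eq hL (fun x => A (pconv L φ u₁ x))] at this
    exact this
  have E₂ : ∀ (i : Fin 3) (k : Lat), ((α ^ 2 : ℝ) : ℂ) * ∑' m : Lat,
      ((∑ a, freq L k a * freq L m a : ℝ) : ℂ) *
        mFourierCoeff (fun θ => ((A (pconv L φ u₂ (sec L θ)) : ℝ) : ℂ)) (fun a => k a - m a) *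
          fc L w₂ m i + fc L w₂ k i = fc L u₂ k i := by
    intro i k
    have := f₂ k i
    simp only [filterLHS, fcS_eq hL (fun x => A (pconv L φ u₂ x))] at this
    exact this
  have est := fun (i : Fin 3) (δ : ℝ) (hδ : 0 ≤ δ)
      (hd : ∀ θ, |A (pconv L φ u₁ (sec L θ)) - A (pconv L φ u₂ (sec L θ))| ≤ δ) =>
    scalar_est (freq L) hα hβ hδ m₁ m₂ (fun θ => hA _) (fun θ => hA _) hd
      (fun k => fc L w₁ k i) (fun k => fc L w₂ k i) (fun k => fc L u₁ k i) (fun k => fc L u₂ k i)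
      (sob_comp r₁ i) (sob_comp r₂ i) (sc₁ i) (sc₂ i) (E₁ i) (E₂ i)
  simp only [← fc_sub hL i₁ i₂, ← fc_sub hL j₁ j₂] at est
  have sd : ∀ i, Summable fun k => ‖fc L (fun x i => u₁ x i - u₂ x i) k i‖ ^ 2 := fun i =>
    (est i 1 zero_le_one (fun θ => by
      have h1 := hA (pconv L φ u₁ (sec L θ))
      have h2 := hA (pconv L φ u₂ (sec L θ))
      rw [abs_le]; constructor <;> linarith)).2.1
  have hd : ∀ θ, |A (pconv L φ u₁ (sec L θ)) - A (pconv L φ u₂ (sec L θ))| ≤ CA * (N * W) := by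
    intro θ
    refine (hlip _ _).trans (mul_le_mul_of_nonneg_left ?_ hCA)
    rw [pi_norm_le_iff_of_nonneg (by positivity)]
    intro i
    refine (pconv_diff hL hφ p₁ p₂ i₁ i₂ sc₁ sc₂ sd (sec L θ) i).trans ?_
    exact mul_le_mul_of_nonneg_left (Real.sqrt_le_sqrt (comp_le_hom hL sd i)) hN0
  have sw := fun i => (est i _ (by positivity) hd).1
  set R := K1c L α β CA φ * (U + 1) * W with hR
  have comp : ∀ i, L ^ 3 * ∑' k, (1 + ∑ a, freq L k a ^ 2) *
      ‖fc L (fun x i => w₁ x i - w₂ x i) k i‖ ^ 2 ≤ R ^ 2 := by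
    intro i
    have h := (est i _ (by positivity) hd).2.2
    refine Real.sqrt_le_iff.1 ?_ |>.2
    rw [Real.sqrt_mul (by positivity)]
    have hl : 0 ≤ √(L ^ 3) := Real.sqrt_nonneg _
    refine (mul_le_mul_of_nonneg_left h hl).trans ?_
    have a1 : √(L ^ 3) * √(∑' k, ‖fc L (fun x i => u₁ x i - u₂ x i) k i‖ ^ 2) ≤ W := by
      rw [← Real.sqrt_mul (by positivity)]
      exact Real.sqrt_le_sqrt (comp_le_hom hL sd i)
    have a2 : √(L ^ 3) * √(∑' k, ‖fc L u₂ k i‖ ^ 2) ≤ U := by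
      rw [← Real.sqrt_mul (by positivity)]
      exact Real.sqrt_le_sqrt (comp_le_hom hL sc₂ i)
    have k1 : K0c α β ≤ K1c L α β CA φ := le_max_right _ _
    have k2 : K0c α β ^ ((3 : ℝ) / 2) * (α ^ 2 * CA * N) ≤ K1c L α β CA φ := le_max_left _ _
    have hp : 0 ≤ K0c α β ^ ((3 : ℝ) / 2) * α ^ 2 * (CA * (N * W)) := by positivity
    calc _ = K0c α β * (√(L ^ 3) * √(∑' k, ‖fc L (fun x i => u₁ x i - u₂ x i) k i‖ ^ 2)) +
          K0c α β ^ ((3 : ℝ) / 2) * α ^ 2 * (CA * (N * W)) *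
            (√(L ^ 3) * √(∑' k, ‖fc L u₂ k i‖ ^ 2)) := by ring
      _ ≤ K0c α β * W + K0c α β ^ ((3 : ℝ) / 2) * α ^ 2 * (CA * (N * W)) * U :=
          add_le_add (mul_le_mul_of_nonneg_left a1 hK0.le) (mul_le_mul_of_nonneg_left a2 hp)
      _ = K0c α β * W + K0c α β ^ ((3 : ℝ) / 2) * (α ^ 2 * CA * N) * (U * W) := by ring
      _ ≤ K1c L α β CA φ * W + K1c L α β CA φ * (U * W) :=
          add_le_add (mul_le_mul_of_nonneg_right k1 hW0)
            (mul_le_mul_of_nonneg_right k2 (by positivity))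
      _ = R := by rw [hR]; ring
  have hK1 : 0 ≤ K1c L α β CA φ := hK0.le.trans (le_max_right _ _)
  have hR0 : 0 ≤ R := by positivity
  rw [show 2 * K1c L α β CA φ * (U + 1) * W = 2 * R by rw [hR]; ring]
  apply Real.sqrt_le_iff.2 ⟨by positivity, ?_⟩
  rw [sobSq_eq sw, Fin.sum_univ_three]
  nlinarith [comp 0, comp 1, comp 2, sq_nonneg R]

end Torus

/-- Proposition 4.2: `H¹` continuous dependence on the data for the
regularized nonlinear filter equation, with constant `K₁ ≃ max(K₀^{3/2}L₁, K₀)`,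
`L₁ = α² C_A ‖φ‖_{L²}` (the constant `C` is absolute). -/
theorem filter_equation_H1_continuous_dependence :
    ∃ C : ℝ, 0 < C ∧
      ∀ (L α β T CA : ℝ) (A : Vec → ℝ) (φ : Pt → ℝ)
        (u₁ u₂ uα₁ uα₂ : ℝ → Pt → Vec),
        0 < L → 0 < α → 0 < β → β < 1 → 0 < T →
        IndicatorBounds β A →
        0 ≤ CA → (∀ x y : Vec, |A x - A y| ≤ CA * ‖x - y‖) →
        KernelL2 L φ →
        (∀ t ∈ Set.Icc (0 : ℝ) T, MemL2s L (u₁ t)) →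
        (∀ t ∈ Set.Icc (0 : ℝ) T, MemL2s L (u₂ t)) →
        (∀ t ∈ Set.Icc (0 : ℝ) T, MemHs L 1 (uα₁ t) ∧ DivFree L (uα₁ t) ∧
          FilterEq L α (fun x => A (pconv L φ (u₁ t) x)) (uα₁ t) (u₁ t)) →
        (∀ t ∈ Set.Icc (0 : ℝ) T, MemHs L 1 (uα₂ t) ∧ DivFree L (uα₂ t) ∧
          FilterEq L α (fun x => A (pconv L φ (u₂ t) x)) (uα₂ t) (u₂ t)) →
        ∀ t ∈ Set.Icc (0 : ℝ) T,
          Real.sqrt (sobSq L 1 fun x i => uα₁ t x i - uα₂ t x i)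
            ≤ C * K1c L α β CA φ * (Real.sqrt (homSobSq L 0 (u₂ t)) + 1) *
              Real.sqrt (homSobSq L 0 fun x i => u₁ t x i - u₂ t x i) := by
  refine ⟨2, two_pos, ?_⟩
  intro L α β T CA A φ u₁ u₂ uα₁ uα₂ hL hα hβ _ _ hA hCA hlip hφ hu₁ hu₂ hw₁ hw₂ t ht
  exact main_est hL hα hβ hA hCA hlip hφ (hu₁ t ht) (hu₂ t ht) (hw₁ t ht).1 (hw₂ t ht).1
    (hw₁ t ht).2.2 (hw₂ t ht).2.2

end NSAlpha
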